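/- arXiv:1011.3384 — 2 statements merged into one kernel-verified Lean document; each statement's English description precedes it below -/
import Mathlib

section
/- A graph G is n-factor-critical if and only if ν(G) ≡ n (mod 2) and for every vertex set S ⊆ V(G) with |S| ≥ n, the number of odd components of G − S is at most |S| − n. -/
open SimpleGraph

/-- `G` has a perfect matching. -/
def HasPM {W : Type*} (G : SimpleGraph W) : Prop :=
  ∃ M : G.Subgraph, M.IsPerfectMatching

/-- `G` is `k`-extendable: `G` is connected, has a matching of size `k`, and every
matching of size `k` extends to a perfect matching. -/
def IsKExtendable {W : Type*} (G : SimpleGraph W) (k : ℕ) : Prop :=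
  G.Connected ∧
  (∃ M : G.Subgraph, M.IsMatching ∧ M.verts.ncard = 2 * k) ∧
  ∀ M : G.Subgraph, M.IsMatching → M.verts.ncard = 2 * k →
    ∃ P : G.Subgraph, P.IsPerfectMatching ∧ M ≤ P

/-- `G` is `n`-factor-critical: deleting any `n` vertices leaves a graph with a
perfect matching. -/
def IsNFactorCritical {W : Type*} (G : SimpleGraph W) (n : ℕ) : Prop :=
  ∀ S : Finset W, S.card = n → HasPM (G.induce ((↑S : Set W)ᶜ))

/-- The independence number of `G`. -/
noncomputable def indepNum {W : Type*} (G : SimpleGraph W) : ℕ :=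
  sSup {n | ∃ s : Finset W, (∀ u ∈ s, ∀ v ∈ s, ¬ G.Adj u v) ∧ s.card = n}

/-- The number of odd connected components of `G`. -/
noncomputable def numOddComponents {W : Type*} (G : SimpleGraph W) : ℕ :=
  Nat.card {c : G.ConnectedComponent // Odd (Nat.card c.supp)}

/-- `G` is `k½`-extendable: `G` is connected and for every vertex `v`, `G - v` has a
matching of size `k` and every matching of size `k` in `G - v` extends to a perfect
matching of `G - v`. -/
def IsHalfExtendable {W : Type*} (G : SimpleGraph W) (k : ℕ) : Prop :=
  G.Connected ∧
  ∀ v : W,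
    (∃ M : (G.induce ({v} : Set W)ᶜ).Subgraph, M.IsMatching ∧ M.verts.ncard = 2 * k) ∧
    ∀ M : (G.induce ({v} : Set W)ᶜ).Subgraph, M.IsMatching → M.verts.ncard = 2 * k →
      ∃ P : (G.induce ({v} : Set W)ᶜ).Subgraph, P.IsPerfectMatching ∧ M ≤ P

/-- The join of two graphs: all edges between the two vertex classes are added. -/
def graphJoin {α β : Type*} (G : SimpleGraph α) (H : SimpleGraph β) :
    SimpleGraph (α ⊕ β) :=
  SimpleGraph.fromRel (fun a b =>
    match a, b with
    | Sum.inl u, Sum.inl v => G.Adj u v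
    | Sum.inr u, Sum.inr v => H.Adj u v
    | _, _ => True)

/-- The disjoint union of two graphs. -/
def graphUnion {α β : Type*} (G : SimpleGraph α) (H : SimpleGraph β) :
    SimpleGraph (α ⊕ β) :=
  SimpleGraph.fromRel (fun a b =>
    match a, b with
    | Sum.inl u, Sum.inl v => G.Adj u v
    | Sum.inr u, Sum.inr v => H.Adj u v
    | _, _ => False)

/-- The join `G ∨ K₁`: one new vertex joined to every vertex of `G`. -/
def joinK1 {W : Type*} (G : SimpleGraph W) : SimpleGraph (W ⊕ Unit) :=
  graphJoin G (⊥ : SimpleGraph Unit)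

/-- `G` is the join of a graph on `n` vertices with the disjoint union of two cliques
of size `m` (intrinsic formulation of `G = G₀ ∨ (K_m ∪ K_m)`). -/
def IsJoinTwoCliques {W : Type*} [Fintype W] [DecidableEq W] (G : SimpleGraph W) (n m : ℕ) : Prop :=
  ∃ S A B : Finset W,
    Disjoint S A ∧ Disjoint S B ∧ Disjoint A B ∧ S ∪ A ∪ B = Finset.univ ∧
    S.card = n ∧ A.card = m ∧ B.card = m ∧
    (∀ u ∈ A, ∀ v ∈ A, u ≠ v → G.Adj u v) ∧
    (∀ u ∈ B, ∀ v ∈ B, u ≠ v → G.Adj u v) ∧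
    (∀ u ∈ A, ∀ v ∈ B, ¬ G.Adj u v) ∧
    (∀ u ∈ S, ∀ v ∈ A ∪ B, G.Adj u v)

/-- `A` induces in `G` the disjoint union of two factor-critical connected components,
each of size at least `minSize`. -/
def TwoFCComponents {W : Type*} [DecidableEq W] (G : SimpleGraph W) (A : Finset W) (minSize : ℕ) : Prop :=
  ∃ B C : Finset W,
    Disjoint B C ∧ B ∪ C = A ∧ minSize ≤ B.card ∧ minSize ≤ C.card ∧
    (∀ u ∈ B, ∀ v ∈ C, ¬ G.Adj u v) ∧
    (G.induce (↑B : Set W)).Connected ∧ (G.induce (↑C : Set W)).Connected ∧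
    IsNFactorCritical (G.induce (↑B : Set W)) 1 ∧
    IsNFactorCritical (G.induce (↑C : Set W)) 1

theorem numOddComponents_congr {V W : Type*} {G : SimpleGraph V} {H : SimpleGraph W}
    (e : G ≃g H) : numOddComponents G = numOddComponents H := by
  refine Nat.card_congr (e.connectedComponentEquiv.subtypeEquiv fun c => ?_)
  have h : Nat.card c.supp = Nat.card (e.connectedComponentEquiv c).supp :=
    Nat.card_congr (ConnectedComponent.isoEquivSupp e c)
  rw [h]

/-- Deleting `T` and then `u` amounts to deleting `T ∪ u`. -/
def deleteVertsInduceIso {V : Type*} (G : SimpleGraph V) (T : Set V) (u : Set ↥Tᶜ) :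
    ((⊤ : (G.induce Tᶜ).Subgraph).deleteVerts u).coe ≃g
      G.induce (T ∪ Subtype.val '' u)ᶜ where
  toFun x := ⟨x.1.1, by
    rintro (h | ⟨y, hy, h⟩)
    · exact x.1.2 h
    · exact x.2.2 (Subtype.val_injective h ▸ hy)⟩
  invFun x := ⟨⟨x.1, fun h => x.2 (Or.inl h)⟩, trivial, fun h => x.2 (Or.inr ⟨_, h, rfl⟩)⟩
  left_inv _ := rfl
  right_inv _ := rfl
  map_rel_iff' := by
    rintro ⟨x, hx⟩ ⟨y, hy⟩
    have hxu : x ∉ u := hx.2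
    have hyu : y ∉ u := hy.2
    simp [hxu, hyu]

/-- Tutte's theorem for the graph obtained by deleting a vertex set `T`. -/
theorem hasPM_induce_compl_iff {V : Type*} [Finite V] (G : SimpleGraph V) (T : Set V) :
    HasPM (G.induce Tᶜ) ↔
      ∀ S : Set V, T ⊆ S → numOddComponents (G.induce Sᶜ) ≤ (S \ T).ncard := by
  have key (u : Set ↥Tᶜ) : ¬ (G.induce Tᶜ).IsTutteViolator u ↔
      numOddComponents (G.induce (T ∪ Subtype.val '' u)ᶜ) ≤
        ((T ∪ Subtype.val '' u) \ T).ncard := by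
    have hdisj : (T ∪ Subtype.val '' u) \ T = Subtype.val '' u := by
      ext x
      simp only [Set.mem_sdiff, Set.mem_union, Set.mem_image]
      constructor
      · rintro ⟨h | h, hT⟩
        · exact absurd h hT
        · exact h
      · rintro ⟨y, hy, rfl⟩
        exact ⟨Or.inr ⟨y, hy, rfl⟩, y.2⟩
    rw [hdisj, Set.ncard_image_of_injective _ Subtype.val_injective,
      ← numOddComponents_congr (deleteVertsInduceIso G T u)]
    exact not_lt
  rw [HasPM, tutte]
  simp_rw [key]
  refine ⟨fun h S hTS => ?_, fun h u => h _ Set.subset_union_left⟩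
  have hS : T ∪ Subtype.val '' ((↑) ⁻¹' S : Set ↥Tᶜ) = S := by
    ext x
    by_cases hx : x ∈ T
    · simp [hx, hTS hx]
    · simp [hx]
  have := h ((↑) ⁻¹' S)
  rwa [hS] at this

/-- G is n-factor-critical iff ν(G) ≡ n (mod 2) and for every S with |S| ≥ n,
the number of odd components of G − S is at most |S| − n. -/
theorem factorCritical_iff_oddComponents {V : Type*} [Fintype V] [DecidableEq V]
    (G : SimpleGraph V) (n : ℕ) (hn : n ≤ Fintype.card V) :
    IsNFactorCritical G n ↔
      (Fintype.card V % 2 = n % 2 ∧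
        ∀ S : Finset V, n ≤ S.card →
          numOddComponents (G.induce ((↑S : Set V)ᶜ)) ≤ S.card - n) := by
  refine ⟨fun h => ⟨?_, fun S hS => ?_⟩, fun ⟨_, h⟩ T hT => ?_⟩
  · obtain ⟨T, -, hT⟩ := Finset.exists_subset_card_eq (s := (Finset.univ : Finset V)) hn
    obtain ⟨M, hM⟩ := h T hT
    have heven := hM.even_card
    have hcard : Fintype.card ↥((T : Set V)ᶜ) = Fintype.card V - n := by
      rw [← Nat.card_eq_fintype_card, Nat.card_coe_set_eq, ← Finset.coe_compl,
        Set.ncard_coe_finset, Finset.card_compl, hT]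
    rw [hcard] at heven
    obtain ⟨k, hk⟩ := heven
    omega
  · obtain ⟨T, hTS, hT⟩ := Finset.exists_subset_card_eq hS
    have := (hasPM_induce_compl_iff G T).mp (h T hT) S (Finset.coe_subset.mpr hTS)
    rwa [← Finset.coe_sdiff, Set.ncard_coe_finset, Finset.card_sdiff_of_subset hTS, hT] at this
  · refine (hasPM_induce_compl_iff G T).mpr fun S hTS => ?_
    lift S to Finset V using S.toFinite
    have hTS' := Finset.coe_subset.mp hTS
    rw [← Finset.coe_sdiff, Set.ncard_coe_finset, Finset.card_sdiff_of_subset hTS', hT]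
    exact h S (hT ▸ Finset.card_le_card hTS')
end

section
/- Let G be a non-bipartite k-extendable graph on ν = 4k vertices with 2k+1 ≤ δ(G) ≤ 3k−1. Then G is not 2k-factor-critical if and only if there is a partition of V(G) into sets V₁, V₂ with |V₁| = |V₂| = 2k such that each of the induced subgraphs G[V₁] and G[V₂] is the disjoint union of two factor-critical components, each of size at least 3. -/
open SimpleGraph

/-- The set `X` is covered by a perfect matching of `G[X]`, given as a fixed-point-free
involution along edges of `G`. -/
def PMOn {V : Type*} (G : SimpleGraph V) (X : Finset V) : Prop :=
  ∃ f : V → V, ∀ x ∈ X, f x ∈ X ∧ f (f x) = x ∧ G.Adj x (f x)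

section Matchings

variable {V : Type*} {G : SimpleGraph V}

theorem hasPM_iff_pmOn {W : Type*} {H : SimpleGraph W} (φ : W → V)
    (hφ : Function.Injective φ) (hadj : ∀ a b, H.Adj a b ↔ G.Adj (φ a) (φ b))
    {X : Finset V} (hX : ∀ v, v ∈ X ↔ ∃ a, φ a = v) : HasPM H ↔ PMOn G X := by
  classical
  constructor
  · rintro ⟨M, hM, hs⟩
    choose g hg hgu using fun a => hM (hs a)
    refine ⟨fun v => if h : ∃ a, φ a = v then φ (g h.choose) else v, fun x hx => ?_⟩
    have key : ∀ a, (if h : ∃ a', φ a' = φ a then φ (g h.choose) else φ a) = φ (g a) := by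
      intro a
      have h : ∃ a', φ a' = φ a := ⟨a, rfl⟩
      rw [dif_pos h, hφ h.choose_spec]
    obtain ⟨a, rfl⟩ := (hX x).1 hx
    simp only [key]
    refine ⟨(hX _).2 ⟨_, rfl⟩, ?_, (hadj _ _).1 (hg a).adj_sub⟩
    rw [← hgu (g a) a (hg a).symm]
  · rintro ⟨f, hf⟩
    have hfX : ∀ a, ∃ b, φ b = f (φ a) := fun a => (hX _).1 (hf _ ((hX _).2 ⟨a, rfl⟩)).1
    choose g hg using hfX
    have hgg : ∀ a, g (g a) = a := fun a => hφ (by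
      rw [hg, hg, (hf _ ((hX _).2 ⟨a, rfl⟩)).2.1])
    refine ⟨{ verts := Set.univ
              Adj := fun a b => g a = b
              adj_sub := ?_
              edge_vert := fun _ => Set.mem_univ _
              symm := ⟨?_⟩ }, ?_, fun _ => Set.mem_univ _⟩
    · rintro a _ rfl
      rw [hadj, hg]
      exact (hf _ ((hX _).2 ⟨a, rfl⟩)).2.2
    · rintro a _ rfl
      exact hgg a
    · intro a _
      exact ⟨g a, rfl, fun b (hb : g a = b) => hb.symm⟩

theorem hasPM_induce_iff {X : Finset V} {s : Set V} (hs : ∀ v, v ∈ X ↔ v ∈ s) :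
    HasPM (G.induce s) ↔ PMOn G X :=
  hasPM_iff_pmOn Subtype.val Subtype.val_injective (fun _ _ => Iff.rfl) (by simp [hs])

namespace PMOn

variable {X Y : Finset V}

theorem congr (h : PMOn G X) (e : X = Y) : PMOn G Y := e ▸ h

theorem mono {G' : SimpleGraph V} (h : PMOn G X) (hle : G ≤ G') : PMOn G' X := by
  obtain ⟨f, hf⟩ := h
  exact ⟨f, fun x hx => ⟨(hf x hx).1, (hf x hx).2.1, hle (hf x hx).2.2⟩⟩

variable [DecidableEq V]

theorem insert_edge {a b : V} (h : PMOn G X) (ha : a ∉ X) (hb : b ∉ X) (hab : G.Adj a b) :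
    PMOn G (insert a (insert b X)) := by
  obtain ⟨f, hf⟩ := h
  have hne := hab.ne
  refine ⟨fun x => if x = a then b else if x = b then a else f x, fun x hx => ?_⟩
  have := hab.symm
  rcases Finset.mem_insert.1 hx with rfl | hx
  · simp [hne.symm, hab]
  rcases Finset.mem_insert.1 hx with rfl | hx
  · simp [hne.symm, this]
  · obtain ⟨h1, h2, h3⟩ := hf x hx
    have e1 : x ≠ a := fun h => ha (h ▸ hx)
    have e2 : x ≠ b := fun h => hb (h ▸ hx)
    have e3 : f x ≠ a := fun h => ha (h ▸ h1)
    have e4 : f x ≠ b := fun h => hb (h ▸ h1)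
    simp [e1, e2, e3, e4, h1, h2, h3]

theorem exists_partner {x : V} (h : PMOn G X) (hx : x ∈ X) :
    ∃ y ∈ X, G.Adj x y ∧ PMOn G (X \ {x, y}) := by
  obtain ⟨f, hf⟩ := h
  refine ⟨f x, (hf x hx).1, (hf x hx).2.2, f, fun z hz => ?_⟩
  have := hf x hx
  grind

theorem inter_of_closed {K : Finset V} (h : PMOn G X)
    (hK : ∀ u ∈ X, ∀ v ∈ X, u ∈ K → G.Adj u v → v ∈ K) : PMOn G (X ∩ K) := by
  obtain ⟨f, hf⟩ := h
  refine ⟨f, fun x hx => ?_⟩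
  have := hf x
  grind

theorem even_card (h : PMOn G X) : Even X.card := by
  induction hn : X.card using Nat.strong_induction_on generalizing X with
  | _ n ih =>
    rcases X.eq_empty_or_nonempty with rfl | ⟨x, hx⟩
    · simp [← hn]
    · obtain ⟨y, hy, hxy, hP⟩ := h.exists_partner hx
      have hc : (X \ {x, y}).card = X.card - 2 := by
        rw [Finset.card_sdiff_of_subset (by grind), Finset.card_pair hxy.ne]
      have h2 : 2 ≤ X.card := by
        rw [← Finset.card_pair hxy.ne]; exact Finset.card_le_card (by grind)
      have := ih _ (by lia) hP rfl
      rw [hc] at this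
      rw [← hn, show X.card = X.card - 2 + 2 by lia]
      exact this.add (by decide)

theorem exists_edge_of_card_lt {A B : Finset V} (h : PMOn G X)
    (hc : X.card < (A ∩ X).card + (B ∩ X).card) :
    ∃ a ∈ A, ∃ b ∈ B, a ∈ X ∧ b ∈ X ∧ G.Adj a b ∧ PMOn G (X \ {a, b}) := by
  obtain ⟨f, hf⟩ := h
  have hinj : Set.InjOn f (B ∩ X : Finset V) := by
    intro x hx y hy hxy
    have h1 := hf x (by simp_all)
    have h2 := hf y (by simp_all)
    rw [← h1.2.1, hxy, h2.2.1]
  have hnd : ¬ Disjoint (A ∩ X) ((B ∩ X).image f) := by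
    intro hd
    have h1 := Finset.card_union_of_disjoint hd
    rw [Finset.card_image_of_injOn hinj] at h1
    have h2 : ((A ∩ X) ∪ (B ∩ X).image f).card ≤ X.card := by
      apply Finset.card_le_card
      intro x hx
      have := hf
      grind
    lia
  obtain ⟨a, ha, hb⟩ := Finset.not_disjoint_iff.1 hnd
  obtain ⟨b, hb, rfl⟩ := Finset.mem_image.1 hb
  have := hf b (by simp_all)
  refine ⟨f b, by simp_all, b, by simp_all, by simp_all, by simp_all, this.2.2.symm, f, ?_⟩
  intro z hz
  have := hf z
  grind

end PMOn

end Matchings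

section Extendability

open Finset

variable {V : Type*} {G : SimpleGraph V} {k : ℕ}

theorem IsKExtendable.exists_pmOn [Finite V] (h : IsKExtendable G k) :
    ∃ X : Finset V, X.card = 2 * k ∧ PMOn G X := by
  classical
  have := Fintype.ofFinite V
  obtain ⟨-, ⟨M, hM, hc⟩, -⟩ := h
  refine ⟨M.verts.toFinset, by rw [← hc, Set.ncard_eq_toFinset_card'], ?_⟩
  choose! g hg hgu using hM
  refine ⟨g, fun x hx => ?_⟩
  rw [Set.mem_toFinset] at hx
  have h1 := hg hx
  have h2 := M.edge_vert h1.symm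
  exact ⟨Set.mem_toFinset.2 h2, (hgu h2 x h1.symm).symm, h1.adj_sub⟩

variable [DecidableEq V]

/-- Interpolating between a perfectly matchable set and a non-matchable one of the same size
gives a set of deficiency exactly two. -/
theorem exists_deficiency_two {S₀ S₁ : Finset V} (hc : S₀.card = S₁.card) (h₀ : PMOn G S₀)
    (h₁ : ¬ PMOn G S₁) :
    ∃ S : Finset V, S.card = S₁.card ∧ ¬ PMOn G S ∧
      ∃ p ∈ S, ∃ q ∈ S, p ≠ q ∧ PMOn G (S \ {p, q}) := by
  induction hn : (S₁ \ S₀).card generalizing S₀ with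
  | zero =>
    have hsub : S₁ ⊆ S₀ := by simpa using hn
    exact absurd (Finset.eq_of_subset_of_card_le hsub hc.le ▸ h₀) h₁
  | succ n ih =>
    obtain ⟨b, hb⟩ := Finset.card_pos.1 (by lia : 0 < (S₁ \ S₀).card)
    have hn' : (S₀ \ S₁).card = n + 1 := by
      rw [← hn]; exact Finset.card_sdiff_comm hc
    obtain ⟨a, ha⟩ := Finset.card_pos.1 (by lia : 0 < (S₀ \ S₁).card)
    rw [Finset.mem_sdiff] at ha hb
    have hcard : (insert b (S₀.erase a)).card = S₁.card := by
      rw [Finset.card_insert_of_notMem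
        (by grind only [mem_insert, mem_singleton, mem_sdiff, mem_compl, mem_erase]),
        Finset.card_erase_add_one ha.1, hc]
    by_cases hP : PMOn G (insert b (S₀.erase a))
    · refine ih hcard hP ?_
      have e : S₁ \ insert b (S₀.erase a) = (S₁ \ S₀).erase b := by
        grind only [mem_insert, mem_singleton, mem_sdiff, mem_compl, mem_erase]
      rw [e, Finset.card_erase_of_mem
        (by grind only [mem_insert, mem_singleton, mem_sdiff, mem_compl, mem_erase]),
        hn, Nat.add_sub_cancel]
    · obtain ⟨c, hc, hac, hQ⟩ := h₀.exists_partner ha.1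
      have := hac.ne
      exact ⟨_, hcard, hP, b,
        by grind only [mem_insert, mem_singleton, mem_sdiff, mem_compl, mem_erase], c,
        by grind only [mem_insert, mem_singleton, mem_sdiff, mem_compl, mem_erase],
        by grind only [mem_insert, mem_singleton, mem_sdiff, mem_compl, mem_erase], hQ.congr
        (by grind only [mem_insert, mem_singleton, mem_sdiff, mem_compl, mem_erase])⟩

variable [Fintype V]

theorem IsKExtendable.pmOn_compl (h : IsKExtendable G k) {X : Finset V} (hX : X.card = 2 * k)
    (hP : PMOn G X) : PMOn G Xᶜ := by
  obtain ⟨f, hf⟩ := hP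
  let M : G.Subgraph :=
    { verts := X
      Adj := fun a b => a ∈ X ∧ f a = b
      adj_sub := by rintro a _ ⟨ha, rfl⟩; exact (hf a ha).2.2
      edge_vert := fun h => h.1
      symm := ⟨by rintro a _ ⟨ha, rfl⟩; exact ⟨(hf a ha).1, (hf a ha).2.1⟩⟩ }
  have hM : M.IsMatching := fun a ha => ⟨f a, ⟨ha, rfl⟩, fun b hb => hb.2.symm⟩
  obtain ⟨P, ⟨hPm, hPs⟩, hle⟩ := h.2.2 M hM (by simp [M, hX])
  choose g hg hgu using fun a => hPm (hPs a)
  refine ⟨g, fun x hx => ?_⟩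
  have hgg : g (g x) = x := (hgu (g x) x (hg x).symm).symm
  refine ⟨?_, hgg, (hg x).adj_sub⟩
  rw [Finset.mem_compl] at hx ⊢
  intro hgx
  have h1 : P.Adj (g x) (f (g x)) := hle.2 ⟨hgx, rfl⟩
  have h2 := hgu _ _ h1
  rw [hgg] at h2
  exact hx (h2 ▸ (hf _ hgx).1)

theorem exists_near_pm_of_cross_edge
    (hext : ∀ X : Finset V, X.card = 2 * k → PMOn G X → PMOn G Xᶜ)
    {S : Finset V} (hS : S.card = 2 * k) {u v x : V} (hu : u ∈ S) (hv : v ∈ S) (huv : u ≠ v)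
    (hP : PMOn G (S \ {u, v})) (hx : x ∉ S) (hux : G.Adj u x) :
    ∃ w ∉ S, w ≠ x ∧ PMOn G (Sᶜ \ {x, w}) := by
  have hZ := hext (insert u (insert x (S \ {u, v})))
    (by
      rw [show insert u (insert x (S \ {u, v})) = insert x (S.erase v) by
        grind only [mem_insert, mem_singleton, mem_sdiff, mem_compl, mem_erase],
        Finset.card_insert_of_notMem
          (by grind only [mem_insert, mem_singleton, mem_sdiff, mem_compl, mem_erase]),
          Finset.card_erase_add_one hv, hS])
    (hP.insert_edge (by simp) (by simp [hx]) hux)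
  obtain ⟨w, hw, hvw, hQ⟩ := hZ.exists_partner (x := v)
    (by grind only [mem_insert, mem_singleton, mem_sdiff, mem_compl, mem_erase])
  have := hvw.ne
  exact ⟨w, by grind only [mem_insert, mem_singleton, mem_sdiff, mem_compl, mem_erase],
    by grind only [mem_insert, mem_singleton, mem_sdiff, mem_compl, mem_erase], hQ.congr
    (by grind only [mem_insert, mem_singleton, mem_sdiff, mem_compl, mem_erase])⟩

/-- If `V` is split into two halves of deficiency two, then every vertex of the second half is
missed by some maximum matching of that half. -/
theorem exists_near_pm_compl
    (hext : ∀ X : Finset V, X.card = 2 * k → PMOn G X → PMOn G Xᶜ)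
    [DecidableRel G.Adj] (hcard : Fintype.card V = 4 * k) (hdeg : ∀ v, 2 * k + 1 ≤ G.degree v)
    {S : Finset V} (hS : S.card = 2 * k) (hnS : ¬ PMOn G S) (hnU : ¬ PMOn G Sᶜ)
    {p q : V} (hp : p ∈ S) (hq : q ∈ S) (hpq : p ≠ q) (hPS : PMOn G (S \ {p, q}))
    {x w : V} (hx : x ∉ S) (hw : w ∉ S) (hxw : x ≠ w) (hPU : PMOn G (Sᶜ \ {x, w}))
    {y : V} (hy : y ∉ S) : ∃ w' ∉ S, w' ≠ y ∧ PMOn G (Sᶜ \ {y, w'}) := by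
  by_contra! hcon
  have hyx : y ≠ x := by rintro rfl; exact hcon w hw hxw.symm hPU
  have hyw : y ≠ w := by
    rintro rfl; exact hcon x hx hxw (hPU.congr
      (by grind only [mem_insert, mem_singleton, mem_sdiff, mem_compl, mem_erase]))
  obtain ⟨z, hz, hyz, hR⟩ := hPU.exists_partner (x := y)
    (by grind only [mem_insert, mem_singleton, mem_sdiff, mem_compl, mem_erase])
  have hzy := hyz.ne
  set R := (Sᶜ \ {x, w}) \ {y, z} with hRdef
  set X := S \ {p, q} with hXdef
  have hmR : ∀ t, t ∈ R ↔ t ∉ S ∧ t ≠ x ∧ t ≠ w ∧ t ≠ y ∧ t ≠ z := by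
    intro t; simp only [hRdef, mem_sdiff, mem_compl, mem_insert, mem_singleton]; tauto
  have hmX : ∀ t, t ∈ X ↔ t ∈ S ∧ t ≠ p ∧ t ≠ q := by
    intro t; simp only [hXdef, mem_sdiff, mem_insert, mem_singleton]; tauto
  obtain ⟨hzS, hzx, hzw⟩ : z ∉ S ∧ z ≠ x ∧ z ≠ w := by simpa [and_assoc] using hz
  clear_value R X
  have hU : Sᶜ.card = 2 * k := by rw [Finset.card_compl, hcard, hS]; lia
  have hcR : R.card + 4 = 2 * k := by
    have e : Sᶜ = insert x (insert w (insert y (insert z R))) := by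
      ext t
      grind only [mem_insert, mem_singleton, mem_sdiff, mem_compl, mem_erase]
    rw [← hU, e, Finset.card_insert_of_notMem
      (by grind only [mem_insert, mem_singleton, mem_sdiff, mem_compl, mem_erase]),
      Finset.card_insert_of_notMem
      (by grind only [mem_insert, mem_singleton, mem_sdiff, mem_compl, mem_erase]),
      Finset.card_insert_of_notMem
        (by grind only [mem_insert, mem_singleton, mem_sdiff, mem_compl, mem_erase]),
        Finset.card_insert_of_notMem
        (by grind only [mem_insert, mem_singleton, mem_sdiff, mem_compl, mem_erase])]
  have hcX : X.card + 2 = 2 * k := by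
    have e : S = insert p (insert q X) := by
      ext t
      grind only [mem_insert, mem_singleton, mem_sdiff, mem_compl, mem_erase]
    rw [← hS, e, Finset.card_insert_of_notMem
      (by grind only [mem_insert, mem_singleton, mem_sdiff, mem_compl, mem_erase]),
      Finset.card_insert_of_notMem
      (by grind only [mem_insert, mem_singleton, mem_sdiff, mem_compl, mem_erase])]
  have nxw : ¬ G.Adj x w := fun h => hnU
    ((hPU.insert_edge (by simp) (by simp) h).congr (by
      ext t
      grind only [mem_insert, mem_singleton, mem_sdiff, mem_compl, mem_erase]))
  have nxz : ¬ G.Adj x z := fun h => hcon w hw hyw.symm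
    ((hR.insert_edge (a := x) (b := z)
      (by grind only [mem_insert, mem_singleton, mem_sdiff, mem_compl, mem_erase])
      (by grind only [mem_insert, mem_singleton, mem_sdiff, mem_compl, mem_erase]) h).congr (by
      ext t
      grind only [mem_insert, mem_singleton, mem_sdiff, mem_compl, mem_erase]))
  have nwz : ¬ G.Adj w z := fun h => hcon x hx hyx.symm
    ((hR.insert_edge (a := w) (b := z)
      (by grind only [mem_insert, mem_singleton, mem_sdiff, mem_compl, mem_erase])
      (by grind only [mem_insert, mem_singleton, mem_sdiff, mem_compl, mem_erase]) h).congr (by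
      ext t
      grind only [mem_insert, mem_singleton, mem_sdiff, mem_compl, mem_erase]))
  have hRle : (G.neighborFinset x ∩ R).card + (G.neighborFinset w ∩ R).card ≤ R.card := by
    by_contra! hlt
    obtain ⟨a, ha, b, hb, haR, hbR, hab, hQ⟩ := hR.exists_edge_of_card_lt hlt
    rw [SimpleGraph.mem_neighborFinset] at ha hb
    have hne := hab.ne
    have h1 := hQ.insert_edge (a := x) (b := a)
      (by grind only [mem_insert, mem_singleton, mem_sdiff, mem_compl, mem_erase])
      (by grind only [mem_insert, mem_singleton, mem_sdiff, mem_compl, mem_erase]) ha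
    have h2 := h1.insert_edge (a := w) (b := b)
      (by grind only [mem_insert, mem_singleton, mem_sdiff, mem_compl, mem_erase])
      (by grind only [mem_insert, mem_singleton, mem_sdiff, mem_compl, mem_erase]) hb
    exact hcon z
      (by
        grind only [mem_insert, mem_singleton, mem_sdiff, mem_compl, mem_erase]) hzy.symm (h2.congr (by
      ext t
      simp only [mem_insert, mem_singleton, mem_sdiff, mem_compl, hmR]
      grind only))
  have hdle : ∀ v, ¬ G.Adj v x → ¬ G.Adj v w → ¬ G.Adj v z →
      2 * k + 1 ≤ (G.neighborFinset v ∩ R).card + (G.neighborFinset v ∩ X).card + 3 := by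
    intro v h1 h2 h3
    calc 2 * k + 1 ≤ (G.neighborFinset v).card := hdeg v
      _ ≤ (((G.neighborFinset v ∩ R) ∪ (G.neighborFinset v ∩ X)) ∪ {p, q, y}).card := by
        apply Finset.card_le_card
        intro t ht
        have := (SimpleGraph.mem_neighborFinset _ _ _).1 ht
        grind (splits := 40) only [mem_insert, mem_singleton, mem_union, mem_inter, mem_sdiff, mem_compl]
      _ ≤ _ := (Finset.card_union_le _ _).trans
        (add_le_add (Finset.card_union_le _ _) Finset.card_le_three)
  have hX := hdle x (G.irrefl) nxw nxz
  have hW := hdle w (fun h => nxw h.symm) (G.irrefl) nwz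
  obtain ⟨a, ha, b, hb, haX, hbX, hab, hQ⟩ :=
    hPS.exists_edge_of_card_lt (A := G.neighborFinset x) (B := G.neighborFinset w) (by lia)
  rw [SimpleGraph.mem_neighborFinset] at ha hb
  have hne := hab.ne
  have h1 := hR.insert_edge (a := x) (b := a)
    (by grind only [mem_insert, mem_singleton, mem_sdiff, mem_compl, mem_erase])
    (by grind only [mem_insert, mem_singleton, mem_sdiff, mem_compl, mem_erase]) ha
  have h2 := h1.insert_edge (a := w) (b := b)
    (by grind only [mem_insert, mem_singleton, mem_sdiff, mem_compl, mem_erase])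
    (by grind only [mem_insert, mem_singleton, mem_sdiff, mem_compl, mem_erase]) hb
  have h3 := hext _ (by
    rw [Finset.card_insert_of_notMem
      (by grind only [mem_insert, mem_singleton, mem_sdiff, mem_compl, mem_erase]),
      Finset.card_insert_of_notMem
      (by grind only [mem_insert, mem_singleton, mem_sdiff, mem_compl, mem_erase]),
      Finset.card_insert_of_notMem
        (by grind only [mem_insert, mem_singleton, mem_sdiff, mem_compl, mem_erase]),
        Finset.card_insert_of_notMem
        (by grind only [mem_insert, mem_singleton, mem_sdiff, mem_compl, mem_erase])]
    lia) h2
  obtain ⟨s, hs, hzs, h4⟩ := h3.exists_partner (x := z)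
    (by grind only [mem_insert, mem_singleton, mem_sdiff, mem_compl, mem_erase])
  have hzs' := hzs.ne
  have hs' : s = y ∨ s ∈ S ∧ s ≠ a ∧ s ≠ b := by
    grind only [mem_insert, mem_singleton, mem_sdiff, mem_compl, mem_erase]
  have h5 := h4.insert_edge (a := a) (b := b)
    (by grind only [mem_insert, mem_singleton, mem_sdiff, mem_compl, mem_erase])
    (by grind only [mem_insert, mem_singleton, mem_sdiff, mem_compl, mem_erase]) hab
  rcases hs' with rfl | ⟨hsS, hsa, hsb⟩
  · exact hnS (h5.congr (by
      ext t
      simp only [mem_insert, mem_singleton, mem_sdiff, mem_compl, hmR]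
      grind only))
  · have h6 := hext (insert y (S.erase s)) (by
      rw [Finset.card_insert_of_notMem
        (by grind only [mem_insert, mem_singleton, mem_sdiff, mem_compl, mem_erase]),
        Finset.card_erase_add_one hsS, hS]) (h5.congr (by
      ext t
      simp only [mem_insert, mem_singleton, mem_sdiff, mem_compl, mem_erase, hmR]
      grind only))
    obtain ⟨w', hw', hsw, h7⟩ := h6.exists_partner (x := s)
      (by grind only [mem_insert, mem_singleton, mem_sdiff, mem_compl, mem_erase])
    have := hsw.ne
    exact hcon w' (by grind only [mem_insert, mem_singleton, mem_sdiff, mem_compl, mem_erase])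
      (by grind only [mem_insert, mem_singleton, mem_sdiff, mem_compl, mem_erase]) (h7.congr (by
      ext t
      grind only [mem_insert, mem_singleton, mem_sdiff, mem_compl, mem_erase]))

end Extendability

section Components

variable {V : Type*} {G : SimpleGraph V}

/-- If no vertex is covered by all near-perfect matchings, Tutte's barrier is empty. -/
theorem exists_odd_closed_of_not_hasPM {W : Type*} [Finite W] {H : SimpleGraph W}
    (hH : ¬ HasPM H) (hnear : ∀ v, ∃ w, HasPM (H ⊔ edge v w)) :
    ∃ B : Set W, Odd B.ncard ∧ ∀ u ∈ B, ∀ v, H.Adj u v → v ∈ B := by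
  obtain ⟨T, hT⟩ : ∃ T, H.IsTutteViolator T := by
    by_contra! h
    exact hH (tutte.2 h)
  obtain rfl : T = ∅ := by
    by_contra! hne
    obtain ⟨v, hv⟩ := hne
    obtain ⟨w, hw⟩ := hnear v
    have e : ((⊤ : H.Subgraph).deleteVerts T).coe =
        ((⊤ : (H ⊔ edge v w).Subgraph).deleteVerts T).coe := by
      ext a b
      have ha : a.1 ≠ v := fun h => a.2.2 (h ▸ hv)
      have hb : b.1 ≠ v := fun h => b.2.2 (h ▸ hv)
      refine Subgraph.deleteVerts_adj.trans (Iff.trans ?_ (Subgraph.deleteVerts_adj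
        (G' := (⊤ : (H ⊔ edge v w).Subgraph))).symm)
      simp [edge_adj, ha, hb]
    refine tutte.1 hw T ?_
    unfold IsTutteViolator at hT ⊢
    rw [← e]
    exact hT
  obtain ⟨c, hc⟩ := Set.nonempty_of_ncard_ne_zero (Nat.ne_of_gt (Nat.zero_lt_of_lt hT))
  refine ⟨Subtype.val '' c.supp, ?_, ?_⟩
  · rw [Set.ncard_image_of_injective _ Subtype.val_injective]
    exact hc
  · rintro _ ⟨u, hu, rfl⟩ v huv
    refine ⟨⟨v, by simp⟩, c.mem_supp_of_adj_mem_supp hu ?_, rfl⟩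
    simpa using huv

variable [DecidableEq V]

theorem isNFactorCritical_one_induce_iff {B : Finset V} :
    IsNFactorCritical (G.induce (B : Set V)) 1 ↔ ∀ v ∈ B, PMOn G (B.erase v) := by
  have key : ∀ v : (B : Set V),
      HasPM ((G.induce (B : Set V)).induce
        (({v} : Finset (B : Set V)) : Set (B : Set V))ᶜ) ↔ PMOn G (B.erase v) := fun v =>
    hasPM_iff_pmOn (fun a => a.1.1) (Subtype.val_injective.comp Subtype.val_injective)
      (fun _ _ => Iff.rfl) (fun u => by
        constructor
        · intro hu
          obtain ⟨huv, hu⟩ := Finset.mem_erase.1 hu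
          refine ⟨⟨⟨u, hu⟩, fun h => huv ?_⟩, rfl⟩
          exact congrArg Subtype.val (Finset.mem_singleton.1 h)
        · rintro ⟨⟨a, ha⟩, rfl⟩
          exact Finset.mem_erase.2 ⟨fun h => ha (Finset.mem_singleton.2 (Subtype.ext h)), a.2⟩)
  constructor
  · intro h v hv
    exact (key ⟨v, hv⟩).1 (h _ (Finset.card_singleton _))
  · intro h S hS
    obtain ⟨v, rfl⟩ := Finset.card_eq_one.1 hS
    exact (key v).2 (h v v.2)

theorem odd_card_of_forall_pmOn_erase {B : Finset V} (hne : B.Nonempty)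
    (h : ∀ v ∈ B, PMOn G (B.erase v)) : Odd B.card := by
  obtain ⟨v, hv⟩ := hne
  rw [← Finset.card_erase_add_one hv]
  exact (h v hv).even_card.add_one

theorem connected_induce_of_forall_pmOn_erase {B : Finset V} (hne : B.Nonempty)
    (h : ∀ v ∈ B, PMOn G (B.erase v)) : (G.induce (B : Set V)).Connected := by
  classical
  have : Nonempty (B : Set V) := hne.coe_sort
  refine ⟨fun a b => ?_⟩
  by_contra hab
  let K : Finset V := B.filter fun u => ∃ hu : u ∈ B, (G.induce (B : Set V)).Reachable a ⟨u, hu⟩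
  have hK : ∀ u ∈ B, ∀ v ∈ B, u ∈ K → G.Adj u v → v ∈ K := by
    intro u _ v hv hu huv
    obtain ⟨-, hu, hr⟩ := Finset.mem_filter.1 hu
    refine Finset.mem_filter.2 ⟨hv, hv, hr.trans (Adj.reachable ?_)⟩
    exact huv
  have haK : a.1 ∈ K := Finset.mem_filter.2 ⟨a.2, a.2, Reachable.refl _⟩
  have hbK : b.1 ∉ K := fun hb => hab (Finset.mem_filter.1 hb).2.2
  have hcl : ∀ x, ∀ u ∈ B.erase x, ∀ v ∈ B.erase x, u ∈ K → G.Adj u v → v ∈ K :=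
    fun x u hu v hv => hK u (Finset.mem_of_mem_erase hu) v (Finset.mem_of_mem_erase hv)
  have hKB : K ⊆ B := Finset.filter_subset _ _
  have h1 := ((h a a.2).inter_of_closed (hcl a)).even_card
  have h2 := ((h b b.2).inter_of_closed (hcl b)).even_card
  rw [show B.erase a ∩ K = K.erase a by grind] at h1
  rw [show B.erase b ∩ K = K by grind, ← Finset.card_erase_add_one haK] at h2
  exact (Nat.not_even_iff_odd.2 h1.add_one) h2

/-- One side of an edgeless cut into two odd parts inherits factor-criticality. -/
theorem pmOn_erase_of_odd_closed {S B : Finset V} (hB : B ⊆ S) (hodd : Odd B.card)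
    (hcl : ∀ u ∈ S, ∀ v ∈ S, u ∈ B → G.Adj u v → v ∈ B)
    (hnear : ∀ v ∈ S, ∃ w ∈ S, w ≠ v ∧ PMOn G (S \ {v, w})) :
    ∀ v ∈ B, PMOn G (B.erase v) := by
  intro v hv
  obtain ⟨w, hw, hwv, hP⟩ := hnear v (hB hv)
  have hQ : PMOn G ((S \ {v, w}) ∩ B) :=
    hP.inter_of_closed fun a ha b hb => hcl a (Finset.mem_sdiff.1 ha).1 b (Finset.mem_sdiff.1 hb).1
  have e : (S \ {v, w}) ∩ B = (B.erase v).erase w := by grind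
  rw [e] at hQ
  by_cases hwB : w ∈ B
  · have h1 := hQ.even_card.add_one
    rw [Finset.card_erase_add_one (Finset.mem_erase.2 ⟨hwv, hwB⟩)] at h1
    have h2 := h1.add_one
    rw [Finset.card_erase_add_one hv] at h2
    exact absurd h2 (Nat.not_even_iff_odd.2 hodd)
  · rwa [Finset.erase_eq_of_notMem (fun h => hwB (Finset.mem_of_mem_erase h))] at hQ

theorem three_le_card_of_odd_closed [Fintype V] [DecidableRel G.Adj] {S B : Finset V}
    (hB : B ⊆ S) (hodd : Odd B.card)
    (hcl : ∀ u ∈ S, ∀ v ∈ S, u ∈ B → G.Adj u v → v ∈ B) (hdeg : ∀ v, Sᶜ.card < G.degree v) :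
    3 ≤ B.card := by
  have h1 : B.card ≠ 1 := by
    intro h
    obtain ⟨b, rfl⟩ := Finset.card_eq_one.1 h
    refine (hdeg b).not_ge (Finset.card_le_card fun v hv => ?_)
    rw [mem_neighborFinset] at hv
    rw [Finset.mem_compl]
    intro hvS
    have := hcl b (hB (Finset.mem_singleton_self b)) v hvS (Finset.mem_singleton_self b) hv
    exact hv.ne (Finset.mem_singleton.1 this).symm
  obtain ⟨m, hm⟩ := hodd
  lia

theorem twoFCComponents_of_near_pm [Fintype V] [DecidableRel G.Adj] {S : Finset V}
    (hS : Even S.card) (hnS : ¬ PMOn G S)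
    (hnear : ∀ v ∈ S, ∃ w ∈ S, w ≠ v ∧ PMOn G (S \ {v, w}))
    (hdeg : ∀ v, Sᶜ.card < G.degree v) : TwoFCComponents G S 3 := by
  obtain ⟨B', hodd', hcl'⟩ := exists_odd_closed_of_not_hasPM
    (H := G.induce (S : Set V)) (by rwa [hasPM_induce_iff (X := S) (by simp)]) (by
      rintro ⟨v, hv⟩
      obtain ⟨w, hw, hwv, hP⟩ := hnear v hv
      refine ⟨⟨w, hw⟩, (hasPM_iff_pmOn (G := G ⊔ edge v w) (X := S) Subtype.val
        Subtype.val_injective ?_ (by simp)).2 ?_⟩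
      · rintro ⟨a, ha⟩ ⟨b, hb⟩
        simp [edge_adj]
      · refine ((hP.mono le_sup_left).insert_edge (a := v) (b := w) (by simp) (by simp) ?_).congr ?_
        · simp [edge_adj, hwv.symm]
        · ext t
          grind)
  classical
  set B : Finset V := S.filter fun v => ∃ hv : v ∈ S, (⟨v, hv⟩ : (S : Set V)) ∈ B' with hBdef
  have hB : B ⊆ S := Finset.filter_subset _ _
  have hodd : Odd B.card := by
    have e : (B : Set V) = Subtype.val '' B' := by
      ext v
      simp [hBdef]
    rwa [← Set.ncard_coe_finset, e, Set.ncard_image_of_injective _ Subtype.val_injective]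
  have hcl : ∀ u ∈ S, ∀ v ∈ S, u ∈ B → G.Adj u v → v ∈ B := by
    intro u _ v hv hu huv
    obtain ⟨-, hu, hu'⟩ := Finset.mem_filter.1 hu
    exact Finset.mem_filter.2 ⟨hv, hv, hcl' _ hu' ⟨v, hv⟩ huv⟩
  have hC : S \ B ⊆ S := Finset.sdiff_subset
  have hoddC : Odd (S \ B).card := by
    rw [Finset.card_sdiff_of_subset hB]
    exact Nat.Even.sub_odd (Finset.card_le_card hB) hS hodd
  have hclC : ∀ u ∈ S, ∀ v ∈ S, u ∈ S \ B → G.Adj u v → v ∈ S \ B := by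
    intro u hu v hv huC huv
    exact Finset.mem_sdiff.2 ⟨hv, fun hvB => (Finset.mem_sdiff.1 huC).2 (hcl v hv u hu hvB huv.symm)⟩
  have hPB := pmOn_erase_of_odd_closed hB hodd hcl hnear
  have hPC := pmOn_erase_of_odd_closed hC hoddC hclC hnear
  exact ⟨B, S \ B, Finset.disjoint_sdiff, Finset.union_sdiff_of_subset hB,
    three_le_card_of_odd_closed hB hodd hcl hdeg,
    three_le_card_of_odd_closed hC hoddC hclC hdeg,
    fun u hu v hv huv => (Finset.mem_sdiff.1 hv).2 (hcl u (hB hu) v (hC hv) hu huv),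
    connected_induce_of_forall_pmOn_erase (Finset.card_pos.1 hodd.pos) hPB,
    connected_induce_of_forall_pmOn_erase (Finset.card_pos.1 hoddC.pos) hPC,
    isNFactorCritical_one_induce_iff.2 hPB, isNFactorCritical_one_induce_iff.2 hPC⟩

theorem TwoFCComponents.not_pmOn {S : Finset V} {n : ℕ} (h : TwoFCComponents G S n) :
    ¬ PMOn G S := by
  obtain ⟨B, C, -, rfl, -, -, hBC, hconn, -, hB, -⟩ := h
  intro hP
  have hne : B.Nonempty := Finset.nonempty_coe_sort.1 hconn.nonempty
  have h1 := odd_card_of_forall_pmOn_erase hne (isNFactorCritical_one_induce_iff.1 hB)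
  have h2 := (hP.inter_of_closed (K := B) (by
    intro u _ v hv hu huv
    by_contra hvB
    exact hBC u hu v ((Finset.mem_union.1 hv).resolve_left hvB) huv)).even_card
  rw [Finset.union_inter_cancel_left] at h2
  exact Nat.not_even_iff_odd.2 h1 h2

end Components

/-- For a non-bipartite k-extendable graph on 4k vertices with 2k+1 ≤ δ(G) ≤ 3k−1:
G is not 2k-factor-critical iff V(G) can be partitioned into V₁, V₂ of size 2k each
where each of G[V₁], G[V₂] is the disjoint union of two factor-critical components
of size at least 3. -/
theorem extendable_4k_not_factorCritical_iff {V : Type*} [Fintype V] [DecidableEq V]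
    (G : SimpleGraph V) [DecidableRel G.Adj] (k : ℕ)
    (hnb : ¬ G.Colorable 2) (hext : IsKExtendable G k)
    (hcard : Fintype.card V = 4 * k)
    (hdeg1 : 2 * k + 1 ≤ G.minDegree) (hdeg2 : G.minDegree ≤ 3 * k - 1) :
    ¬ IsNFactorCritical G (2 * k) ↔
      ∃ V₁ V₂ : Finset V, Disjoint V₁ V₂ ∧ V₁ ∪ V₂ = Finset.univ ∧
        V₁.card = 2 * k ∧ V₂.card = 2 * k ∧
        TwoFCComponents G V₁ 3 ∧ TwoFCComponents G V₂ 3 := by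
  have hdeg : ∀ v, 2 * k + 1 ≤ G.degree v := fun v => hdeg1.trans (G.minDegree_le_degree v)
  have hextP : ∀ X : Finset V, X.card = 2 * k → PMOn G X → PMOn G Xᶜ :=
    fun X hX hP => hext.pmOn_compl hX hP
  have hcompl : ∀ S : Finset V, S.card = 2 * k → Sᶜ.card = 2 * k := by
    intro S hS
    rw [Finset.card_compl, hcard, hS]
    lia
  constructor
  · intro hnfc
    obtain ⟨S₁, hS₁, hnS₁⟩ : ∃ S₁ : Finset V, S₁.card = 2 * k ∧ ¬ PMOn G S₁ := by
      by_contra! hall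
      exact hnfc fun S hS => (hasPM_induce_iff (X := Sᶜ) (by simp)).2 (hall _ (hcompl S hS))
    obtain ⟨S₀, hS₀, hPS₀⟩ := hext.exists_pmOn
    obtain ⟨S, hS, hnS, p, hp, q, hq, hpq, hPS⟩ :=
      exists_deficiency_two (hS₀.trans hS₁.symm) hPS₀ hnS₁
    rw [hS₁] at hS
    have hU := hcompl S hS
    have hnU : ¬ PMOn G Sᶜ := fun h => hnS (by simpa using hextP _ hU h)
    obtain ⟨x, hpx, hx⟩ : ∃ x ∈ G.neighborFinset p, x ∉ S :=
      Finset.exists_mem_notMem_of_card_lt_card (by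
        rw [card_neighborFinset_eq_degree, hS]
        exact hdeg p)
    rw [mem_neighborFinset] at hpx
    obtain ⟨w, hw, hwx, hPU⟩ := exists_near_pm_of_cross_edge hextP hS hp hq hpq hPS hx hpx
    have hnearU : ∀ y ∈ Sᶜ, ∃ w ∈ Sᶜ, w ≠ y ∧ PMOn G (Sᶜ \ {y, w}) := by
      intro y hy
      simpa using exists_near_pm_compl hextP hcard hdeg hS hnS hnU hp hq hpq hPS hx hw
        hwx.symm hPU (Finset.mem_compl.1 hy)
    have hnearS : ∀ y ∈ S, ∃ w ∈ S, w ≠ y ∧ PMOn G (S \ {y, w}) := by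
      intro y hy
      simpa using exists_near_pm_compl (S := Sᶜ) hextP hcard hdeg hU hnU (by simpa using hnS)
        (Finset.mem_compl.2 hx) (Finset.mem_compl.2 hw) hwx.symm hPU (x := p) (w := q)
        (by simpa using hp) (by simpa using hq) hpq (by simpa using hPS) (y := y)
        (by simpa using hy)
    refine ⟨S, Sᶜ, disjoint_compl_right, Finset.union_compl S, hS, hU, ?_, ?_⟩
    · exact twoFCComponents_of_near_pm (hS ▸ even_two_mul k) hnS hnearS
        fun v => by rw [hU]; exact hdeg v
    · exact twoFCComponents_of_near_pm (hU ▸ even_two_mul k) hnU hnearU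
        fun v => by rw [compl_compl, hS]; exact hdeg v
  · rintro ⟨V₁, V₂, hd, hu, h₁, -, -, hV₂⟩ hfc
    refine hV₂.not_pmOn ((hasPM_induce_iff (X := V₂) fun v => ?_).1 (hfc V₁ h₁))
    have hv := Finset.mem_univ v
    rw [← hu, Finset.mem_union] at hv
    have : v ∈ V₁ → v ∉ V₂ := fun h => Finset.disjoint_left.1 hd h
    simp only [Set.mem_compl_iff, Finset.mem_coe]
    tauto
end
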